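/- arXiv:1306.5443 — 3 statements merged into one kernel-verified Lean document; each statement's English description precedes it below -/
import Mathlib

section
/- Let G be a finite group generated by two elements a and b with a² = b³ = e, and suppose |G| ≥ 9·|ab²|, where |ab²| denotes the order of the element ab². Then the Cayley digraph Cay(G; {a,b}) has no hamiltonian path. -/
/-- A hamiltonian path in the Cayley digraph `Cay(G;S)`: a list of all vertices,
without repetition, in which each vertex is followed by a vertex obtained by
multiplying on the right by an element of `S`. -/
def IsHamiltonianPath {G : Type*} [Group G] (S : Set G) (l : List G) : Prop :=
  l.Nodup ∧ (∀ g : G, g ∈ l) ∧ l.Chain' (fun x y => ∃ s ∈ S, y = x * s)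

/-- A left coset of a cyclic subgroup has as many elements as the order of a generator. -/
theorem ncard_leftCoset_zpowers {G : Type*} [Group G] (c x : G) :
    ((fun h => x * h) '' (Subgroup.zpowers c : Set G)).ncard = orderOf c := by
  rw [Set.ncard_image_of_injective _ (mul_right_injective x), ← Nat.card_zpowers]
  rfl

/-- If every right translate by a power of an element of order dividing three meets `s`,
then `s` contains at least a third of the group. -/
theorem card_le_three_mul_ncard {G : Type*} [Group G] [Finite G] {b : G} (hb : b ^ 3 = 1)
    (s : Set G) (hs : ∀ x, x ∈ s ∨ x * b ∈ s ∨ x * b * b ∈ s) :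
    Nat.card G ≤ 3 * s.ncard := by
  have hbbb : b * b * b = 1 := by rw [← hb, pow_succ, pow_two]
  have hcover : (Set.univ : Set G) ⊆
      (s ∪ (fun y => y * (b * b)) '' s) ∪ (fun y => y * b) '' s := by
    intro x _
    rcases hs x with h | h | h
    · exact Or.inl (Or.inl h)
    · exact Or.inl (Or.inr ⟨_, h, by simp only [mul_assoc] at hbbb ⊢; rw [hbbb, mul_one]⟩)
    · exact Or.inr ⟨_, h, by simp only [mul_assoc] at hbbb ⊢; rw [hbbb, mul_one]⟩
  have h1 := Set.ncard_le_ncard hcover (Set.toFinite _)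
  have h2 := Set.ncard_union_le (s ∪ (fun y => y * (b * b)) '' s) ((fun y => y * b) '' s)
  have h3 := Set.ncard_union_le s ((fun y => y * (b * b)) '' s)
  have h4 := Set.ncard_image_le (f := fun y => y * (b * b)) (Set.toFinite s)
  have h5 := Set.ncard_image_le (f := fun y => y * b) (Set.toFinite s)
  rw [Set.ncard_univ] at h1
  lia

/-- The position function `e` of a hamiltonian path from `x₀` to `t` in `Cay(G;{a,b})`, where
`a² = b³ = 1`, forces the order of `G` to be less than nine times the order of `ab²`. -/
theorem card_lt_of_position {G : Type*} [Group G] [Finite G] {a b : G} (hab : a ≠ b)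
    (ha : a ^ 2 = 1) (hb : b ^ 3 = 1) (e : G → ℕ) (he : Function.Injective e) (x₀ t : G)
    (ht : ∀ x, e x ≤ e t)
    (hsucc : ∀ x, x = t ∨ e (x * a) = e x + 1 ∨ e (x * b) = e x + 1)
    (hpred : ∀ x, x = x₀ ∨ e (x * a) + 1 = e x ∨ e (x * b ^ 2) + 1 = e x)
    (hx₀ : ∀ x, e x₀ ≤ e x) :
    Nat.card G < 9 * orderOf (a * b ^ 2) := by
  set c := a * b ^ 2 with hc
  have haa (x : G) : x * a * a = x := by rw [mul_assoc, ← pow_two, ha, mul_one]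
  have hb21 (x : G) : x * b ^ 2 * b = x := by rw [mul_assoc, ← pow_succ, hb, mul_one]
  have hb12 (x : G) : x * b * b ^ 2 = x := by rw [mul_assoc, ← pow_succ', hb, mul_one]
  have hbb (x : G) : x * b * b = x * b ^ 2 := by rw [mul_assoc, ← pow_two]
  have hxc (x : G) : x * c = x * a * b ^ 2 := by rw [hc, mul_assoc]
  have hcinv : c⁻¹ = b * a := by
    rw [inv_eq_iff_mul_eq_one, ← mul_assoc, hc, hb21, ← pow_two, ha]
  have hc_mem : c ∈ Subgroup.zpowers c := Subgroup.mem_zpowers c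
  have hba_mem : b * a ∈ Subgroup.zpowers c := hcinv ▸ inv_mem hc_mem
  set H := Subgroup.zpowers c
  let A : Set G := {x | e (x * a) = e x + 1}
  have htA : t ∉ A := fun h => by have := ht (t * a); simp only [A, Set.mem_ofPred_eq] at h; lia
  -- two consecutive steps by `a` would return to the starting point
  have hA_a {x : G} (hx : x ∈ A) : x * a ∉ A := fun h => by
    simp only [A, Set.mem_ofPred_eq, haa] at hx h
    lia
  have hA_c {x : G} (hx : x ∈ A) : x * c = t ∨ x * c ∈ A := by
    rcases hsucc (x * c) with h | h | h
    · exact Or.inl h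
    · exact Or.inr h
    · exfalso
      rw [hxc, hb21] at h
      have h1 : x * a * b ^ 2 = x := he (by simp only [A, Set.mem_ofPred_eq] at hx; lia)
      apply hab
      have h2 : x * a = x * b := by rw [← hb21 (x * a), h1]
      exact mul_left_cancel h2
  have hcoset {x : G} (hx : x ∈ A) (hxt : ∀ h ∈ H, x * h ≠ t) : ∀ h ∈ H, x * h ∈ A := by
    intro h hh
    obtain ⟨k, rfl⟩ := (mem_powers_iff_mem_zpowers.mpr hh)
    clear hh
    induction k with
    | zero => simpa using hx
    | succ k ih =>
      simp only [pow_succ, ← mul_assoc] at ih ⊢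
      refine (hA_c ih).resolve_left ?_
      rw [mul_assoc, ← pow_succ]
      exact hxt _ (Subgroup.npow_mem_zpowers c _)
  -- a coset travelling by `a` that avoids the ends of the path would be traversed cyclically
  have hends {x : G} (hx : ∀ h ∈ H, x * h ∈ A) :
      ∃ h ∈ H, x * h = t * a ∨ x * h = t * b ∨ x * h = x₀ := by
    by_contra! hcon
    obtain ⟨m, hmH, hmax⟩ := Set.exists_max_image (H : Set G) (fun h => e (x * h))
      (Set.toFinite _) ⟨1, H.one_mem⟩
    have hmc : m * c ∈ H := H.mul_mem hmH hc_mem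
    have hmax' := hmax _ hmc
    have hA1 : e (x * m * a) = e (x * m) + 1 := hx m hmH
    have hA2 : e (x * m * a * b ^ 2 * a) = e (x * m * a * b ^ 2) + 1 := by
      have := hx _ hmc
      simpa only [A, Set.mem_ofPred_eq, ← mul_assoc, hc] using this
    have hB1 : e (x * m * a * b) = e (x * m * a) + 1 := by
      rcases hsucc (x * m * a) with h | h | h
      · exact absurd (by rw [← h, haa]) (hcon m hmH).1
      · exact absurd h (hA_a (hx m hmH))
      · exact h
    have hB2 : e (x * m * a * b ^ 2) = e (x * m * a * b) + 1 := by
      rw [← hbb]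
      rcases hsucc (x * m * a * b) with h | h | h
      · exact absurd (by rw [← h, hbb, ← mul_assoc, hxc]) (hcon _ hmc).2.1
      · exfalso
        rcases hpred (x * m * a * b ^ 2) with h' | h' | h'
        · exact (hcon _ hmc).2.2 (by rw [← mul_assoc, hxc, h'])
        · lia
        · rw [← hbb (x * m * a * b ^ 2), hb21] at h'
          have h'' : x * m * a * b * a = x * m * a * b ^ 2 := he (by lia)
          rw [← hbb] at h''
          exact hab (mul_left_cancel h'')
      · exact h
    rw [← mul_assoc, hxc] at hmax'
    lia
  have hmem {x y h : G} (hh : h ∈ H) (hxy : x * h = y) :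
      x ∈ (fun k => y * k) '' (H : Set G) :=
    ⟨h⁻¹, H.inv_mem hh, by simp [← hxy]⟩
  -- `taH` and `tbH` do not both travel by `a`
  have hone : ∃ u, ∀ x, (∀ h ∈ H, x * h ∈ A) →
      x ∈ (fun k => u * k) '' (H : Set G) ∪ (fun k => x₀ * k) '' (H : Set G) ∧
      (x₀ = t * a → x ∈ (fun k => u * k) '' (H : Set G)) := by
    have hmove {x y h : G} (hx : ∀ h ∈ H, x * h ∈ A) (hh : h ∈ H) (hxy : x * h = y) :
        ∀ k ∈ H, y * k ∈ A := fun k hk => by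
      rw [← hxy, mul_assoc]
      exact hx _ (H.mul_mem hh hk)
    by_cases hta : ∀ k ∈ H, t * a * k ∈ A
    · refine ⟨t * a, fun x hx => ?_⟩
      obtain ⟨h, hh, h1 | h1 | h1⟩ := hends hx
      · exact ⟨Or.inl (hmem hh h1), fun _ => hmem hh h1⟩
      · exfalso
        have h2 : t * b * b * a ∈ A := by
          rw [mul_assoc (t * b)]
          exact hmove hx hh h1 _ hba_mem
        have h3 : t * b * b ∈ A := by
          have h4 := hta c hc_mem
          rwa [hxc, haa, ← hbb] at h4
        exact hA_a h3 h2
      · exact ⟨Or.inr (hmem hh h1), fun h2 => hmem hh (h1.trans h2)⟩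
    · refine ⟨t * b, fun x hx => ?_⟩
      obtain ⟨h, hh, h1 | h1 | h1⟩ := hends hx
      · exact absurd (hmove hx hh h1) hta
      · exact ⟨Or.inl (hmem hh h1), fun _ => hmem hh h1⟩
      · exact ⟨Or.inr (hmem hh h1), fun h2 => absurd (hmove hx hh (h1.trans h2)) hta⟩
  obtain ⟨u, hu⟩ := hone
  have hA_sub {x : G} (hx : x ∈ A) :
      (∀ h ∈ H, x * h ∈ A) ∨ x ∈ (fun k => t * k) '' (H : Set G) := by
    by_cases hxt : ∀ h ∈ H, x * h ≠ t
    · exact Or.inl (hcoset hx hxt)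
    · push Not at hxt
      obtain ⟨h, hh, hxh⟩ := hxt
      exact Or.inr (hmem hh hxh)
  have hA_card : A.ncard + 2 ≤ 3 * orderOf c := by
    have hpos : 0 < orderOf c := orderOf_pos c
    set T := (fun k => t * k) '' (H : Set G)
    set U := (fun k => u * k) '' (H : Set G)
    have hTcard : T.ncard = orderOf c := ncard_leftCoset_zpowers c t
    have hUcard : U.ncard = orderOf c := ncard_leftCoset_zpowers c u
    have htT : t ∈ T := ⟨1, H.one_mem, mul_one t⟩
    have hTt := Set.ncard_sdiff_singleton_add_one htT (Set.toFinite _)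
    by_cases hz : ∃ z ∈ T, z ≠ t ∧ z ∉ A
    · obtain ⟨z, hzT, hzt, hzA⟩ := hz
      have hTtz := Set.ncard_sdiff_singleton_add_one (show z ∈ T \ {t} from ⟨hzT, hzt⟩)
        (Set.toFinite _)
      set X := (fun k => x₀ * k) '' (H : Set G)
      have hXcard : X.ncard = orderOf c := ncard_leftCoset_zpowers c x₀
      have hsub : A ⊆ (U ∪ X) ∪ (T \ {t}) \ {z} := fun x hx => by
        rcases hA_sub hx with h | h
        · exact Or.inl (hu x h).1
        · exact Or.inr ⟨⟨h, fun h' => htA (h' ▸ hx)⟩, fun h' => hzA (h' ▸ hx)⟩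
      have h1 := Set.ncard_le_ncard hsub (Set.toFinite _)
      have h2 := Set.ncard_union_le (U ∪ X) ((T \ {t}) \ {z})
      have h3 := Set.ncard_union_le U X
      lia
    · push Not at hz
      have hx₀A : x₀ * a ∉ A := fun h => by
        have := hx₀ (x₀ * a)
        simp only [A, Set.mem_ofPred_eq, haa] at h
        lia
      have hx₀c : x₀ * a * c = x₀ * b ^ 2 := by rw [hxc, haa]
      have hx₀t : x₀ * a = t := by
        by_contra hne
        have hnT : x₀ * b ^ 2 ∉ T := fun ⟨k, hk, h⟩ => by
          refine hx₀A (hz _ ⟨k * c⁻¹, H.mul_mem hk (H.inv_mem hc_mem), ?_⟩ hne)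
          simp only at h ⊢
          rw [← mul_assoc, h, ← hx₀c, mul_inv_cancel_right]
        rcases hsucc (x₀ * b ^ 2) with h | h | h
        · exact hnT (h ▸ htT)
        · rcases hA_sub h with h' | h'
          · have := h' _ (H.inv_mem hc_mem)
            rw [← hx₀c, mul_inv_cancel_right] at this
            exact hx₀A this
          · exact hnT h'
        · have := hx₀ (x₀ * b ^ 2)
          rw [hb21] at h
          lia
      have hsub : A ⊆ U ∪ T \ {t} := fun x hx => by
        rcases hA_sub hx with h | h
        · exact Or.inl ((hu x h).2 (by rw [← hx₀t, haa]))
        · exact Or.inr ⟨h, fun h' => htA (h' ▸ hx)⟩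
      have h1 := Set.ncard_le_ncard hsub (Set.toFinite _)
      have h2 := Set.ncard_union_le U (T \ {t})
      lia
  have hthird := card_le_three_mul_ncard hb (insert t A) (by
    intro x
    by_contra! hcon
    simp only [Set.mem_insert_iff, not_or] at hcon
    obtain ⟨⟨h1, h1'⟩, ⟨h2, h2'⟩, ⟨h3, h3'⟩⟩ := hcon
    have e1 := ((hsucc _).resolve_left h1).resolve_left h1'
    have e2 := ((hsucc _).resolve_left h2).resolve_left h2'
    have e3 := ((hsucc _).resolve_left h3).resolve_left h3'
    rw [hbb x, hb21] at e3
    rw [hbb] at e2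
    lia)
  have := Set.ncard_insert_le t A
  lia

theorem stmt_15 {G : Type*} [Group G] [Finite G] (a b : G)
    (hgen : Subgroup.closure ({a, b} : Set G) = ⊤)
    (ha : a ^ 2 = 1) (hb : b ^ 3 = 1)
    (hcard : 9 * orderOf (a * b ^ 2) ≤ Nat.card G) :
    ¬ ∃ l : List G, IsHamiltonianPath ({a, b} : Set G) l := by
  classical
  rintro ⟨l, hnd, hall, hchain⟩
  have hd : 0 < orderOf (a * b ^ 2) := orderOf_pos _
  have hab : a ≠ b := by
    rintro rfl
    have ha1 : a = 1 := by rw [pow_succ, ha, one_mul] at hb; exact hb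
    subst ha1
    have hbot : (⊤ : Subgroup G) = ⊥ := by
      simpa [Subgroup.closure_singleton_one] using hgen.symm
    have : Nat.card G = 1 := by rw [← Subgroup.card_top, hbot, Subgroup.card_bot]
    lia
  have hstep (i : ℕ) (hi : i + 1 < l.length) : l[i + 1] = l[i] * a ∨ l[i + 1] = l[i] * b := by
    obtain ⟨s, hs, h⟩ := List.isChain_iff_getElem.mp hchain i hi
    rcases hs with rfl | rfl
    · exact Or.inl h
    · exact Or.inr h
  have hlt (x : G) : l.idxOf x < l.length := List.idxOf_lt_length_iff.mpr (hall x)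
  have hpos : 0 < l.length := (Nat.zero_le _).trans_lt (hlt 1)
  have hidx (i : ℕ) (hi : i < l.length) : l.idxOf l[i] = i := hnd.idxOf_getElem i hi
  have hget (x : G) : l[l.idxOf x]'(hlt x) = x := List.getElem_idxOf (hlt x)
  refine absurd hcard (not_le.mpr (card_lt_of_position hab ha hb (fun x => l.idxOf x) ?_ l[0]
    (l[l.length - 1]) ?_ ?_ ?_ ?_))
  · intro x y hxy
    exact (List.idxOf_inj (hall x)).mp hxy
  · intro x
    have := hlt x
    simp only [hidx]
    lia
  · intro x
    by_cases hx : l.idxOf x + 1 < l.length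
    · right
      have h := hstep _ hx
      have h' := hidx _ hx
      rw [hget] at h
      rcases h with h | h
      · left; rw [← h, h']
      · right; rw [← h, h']
    · left
      have := hlt x
      have h : l.idxOf x = l.length - 1 := by lia
      rw [← hget x]
      simp only [h]
  · intro x
    rcases hk : l.idxOf x with _ | k
    · left
      rw [← hget x]
      simp only [hk]
    · right
      have hlx := hlt x
      have hk1 : k + 1 < l.length := hk ▸ hlx
      have hx : l[k + 1] = x := by rw [← hget x]; simp only [hk]
      have h' := hidx k (by lia)
      rcases hstep k hk1 with h | h
      · left
        rw [hx] at h
        rw [h, mul_assoc, ← pow_two, ha, mul_one, h']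
      · right
        rw [hx] at h
        rw [h, mul_assoc, ← pow_succ', hb, mul_one, h']
  · intro x
    simp only [hidx]
    lia
end

section
/- Let G = Z_12 ⋉ Z_5 = ⟨h⟩ ⋉ ⟨z⟩ with z^h = z³. Then the commutator subgroup of G has order 5, and the Cayley digraph Cay(G; h²z, h³z) is connected but has no hamiltonian path. -/
/-- With `(i, j)` standing for `z ^ i * h ^ j`, right multiplication by `h ^ e * z`. -/
def moveBy (e : ℕ) (v : ℕ × ℕ) : ℕ × ℕ :=
  ((v.1 + 2 ^ (v.2 + e)) % 5, (v.2 + e) % 12)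

/-- The vertices that use the generator `h ^ 2 * z`: the first `k` nontrivial powers of `h`,
and the cosets of `⟨h⟩` selected by the four Booleans. -/
def usesSquare (b₁ b₂ b₃ b₄ : Bool) (k : ℕ) : ℕ → ℕ → Bool
  | 0, j => Nat.ble j k
  | 1, _ => b₁
  | 2, _ => b₂
  | 3, _ => b₃
  | _, _ => b₄

/-- One step along a spanning subdigraph in which only `(0, 0)` has no successor;
`(0, 0)` is made a fixed point. -/
def stepBy (p : ℕ → ℕ → Bool) (v : ℕ × ℕ) : ℕ × ℕ :=
  bif Nat.beq v.1 0 && Nat.beq v.2 0 then v else bif p v.1 v.2 then moveBy 2 v else moveBy 3 v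

theorem moveBy_lt (e : ℕ) (v : ℕ × ℕ) : (moveBy e v).1 < 5 ∧ (moveBy e v).2 < 12 :=
  ⟨Nat.mod_lt _ (by norm_num), Nat.mod_lt _ (by norm_num)⟩

theorem stepBy_of_ne {p : ℕ → ℕ → Bool} {v : ℕ × ℕ} (hv : v ≠ (0, 0)) :
    stepBy p v = bif p v.1 v.2 then moveBy 2 v else moveBy 3 v := by
  have : (Nat.beq v.1 0 && Nat.beq v.2 0) = false := by
    rw [Bool.eq_false_iff]
    intro h
    simp only [Bool.and_eq_true, Nat.beq_eq] at h
    exact hv (Prod.ext h.1 h.2)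
  rw [stepBy, this, cond_false]

theorem stepBy_zero (p : ℕ → ℕ → Bool) : stepBy p (0, 0) = (0, 0) := rfl

theorem moveBy_two_eq : ∀ i < 5, ∀ j < 12,
    moveBy 2 (i, j) = moveBy 3 (i, (j + 11) % 12) := by
  decide +kernel

/-- Every candidate spanning subdigraph contains a cycle. -/
theorem exists_iterate_stepBy_ne : ∀ b₁ b₂ b₃ b₄ : Bool, ∀ k < 12,
    ∃ v ∈ [(1, 3), (2, 3), (4, 11), (2, 2), (0, 3)],
      (stepBy (usesSquare b₁ b₂ b₃ b₄ k))^[60] v ≠ (0, 0) := by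
  decide +kernel

theorem exists_eq_ble {q : ℕ → Bool} {n : ℕ}
    (hq : ∀ j, 0 < j → j < n → q (j + 1) = true → q j = true) :
    ∃ k ≤ n, ∀ j, 0 < j → j ≤ n → q j = Nat.ble j k := by
  refine ⟨Nat.findGreatest (fun j => q j = true) n, Nat.findGreatest_le _, fun j hj hjn => ?_⟩
  rw [Bool.eq_iff_iff, Nat.ble_eq]
  refine ⟨fun h => Nat.le_findGreatest hjn h, fun hjk => ?_⟩
  have hk : q (Nat.findGreatest (fun j => q j = true) n) = true :=
    Nat.findGreatest_of_ne_zero (P := fun j => q j = true) rfl (by omega)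
  have hkn := Nat.findGreatest_le (P := fun j => q j = true) n
  generalize Nat.findGreatest (fun j => q j = true) n = k at *
  induction k, hjk using Nat.le_induction with
  | base => exact hk
  | succ m hm ih => exact ih (hq m (by omega) (by omega) hk) (by omega)

theorem eq_zero_of_cyclic {q : ℕ → Bool} {n : ℕ}
    (hq : ∀ j < n, q (j + 1) = true → q j = true) (h0 : q 0 = true → q n = true) :
    ∀ j ≤ n, q j = q 0 := by
  have hanti : ∀ i j, i ≤ j → j ≤ n → q j = true → q i = true := by
    intro i j hij
    induction j, hij using Nat.le_induction with
    | base => exact fun _ h => h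
    | succ m hm ih => exact fun hmn h => ih (by omega) (hq m (by omega) h)
  intro j hj
  rw [Bool.eq_iff_iff]
  exact ⟨hanti 0 j (by omega) hj, fun h => hanti j n hj le_rfl (h0 h)⟩

theorem false_of_moveBy_ordering (f : ℕ × ℕ → ℕ)
    (hb : ∀ v : ℕ × ℕ, f v < 60)
    (hinj : ∀ i j i' j', i < 5 → j < 12 → i' < 5 → j' < 12 → f (i, j) = f (i', j') →
      i = i' ∧ j = j')
    (hs : ∀ v : ℕ × ℕ, v.1 < 5 → v.2 < 12 → v ≠ (0, 0) →
      f (moveBy 2 v) = f v + 1 ∨ f (moveBy 3 v) = f v + 1) : False := by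
  obtain ⟨p, hp⟩ : ∃ p : ℕ → ℕ → Bool, ∀ i j, p i j = true ↔ f (moveBy 2 (i, j)) = f (i, j) + 1 :=
    ⟨fun i j => decide (f (moveBy 2 (i, j)) = f (i, j) + 1), by simp⟩
  have hpred : ∀ i < 5, ∀ j < 12, (i, (j + 11) % 12) ≠ (0, 0) → p i j = true →
      p i ((j + 11) % 12) = true := by
    intro i hi j hj hne h
    have hj' : (j + 11) % 12 < 12 := Nat.mod_lt _ (by norm_num)
    rw [hp] at h ⊢
    refine (hs (i, (j + 11) % 12) hi hj' hne).resolve_right fun h3 => ?_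
    rw [← moveBy_two_eq i hi j hj] at h3
    have := hinj i j i _ hi hj hi hj' (by omega)
    omega
  have hsucc : ∀ i < 5, ∀ j < 11, (i, j) ≠ (0, 0) → p i (j + 1) = true → p i j = true := by
    intro i hi j hj hne h
    have hj' : (j + 1 + 11) % 12 = j := by omega
    simpa [hj'] using hpred i hi (j + 1) (by omega) (by simpa [hj'] using hne) h
  have hcoset : ∀ i < 5, i ≠ 0 → ∀ j ≤ 11, p i j = p i 0 := fun i hi h0 =>
    eq_zero_of_cyclic (fun j hj => hsucc i hi j hj (by simp [h0]))
      (hpred i hi 0 (by norm_num) (by simp))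
  obtain ⟨k, hk, hpk⟩ := exists_eq_ble (q := p 0) (n := 11) fun j h0 hj =>
    hsucc 0 (by norm_num) j hj (by simp; omega)
  set u := usesSquare (p 1 0) (p 2 0) (p 3 0) (p 4 0) k with hu
  have hpu : ∀ v : ℕ × ℕ, v.1 < 5 → v.2 < 12 → v ≠ (0, 0) → p v.1 v.2 = u v.1 v.2 := by
    rintro ⟨i, j⟩ hi hj hne
    dsimp only at hi hj ⊢
    rcases Nat.eq_zero_or_pos i with rfl | h0
    · have : j ≠ 0 := fun h => hne (by rw [h])
      exact hpk j (by omega) (by omega)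
    · rw [hcoset i hi h0.ne' j (by omega), hu]
      interval_cases i <;> rfl
  have hstep : ∀ v : ℕ × ℕ, v.1 < 5 → v.2 < 12 → v ≠ (0, 0) → f (stepBy u v) = f v + 1 := by
    intro v hi hj hne
    rw [stepBy_of_ne hne, ← hpu v hi hj hne]
    cases h : p v.1 v.2 with
    | true => exact (hp _ _).1 h
    | false =>
      refine (hs v hi hj hne).resolve_left fun h2 => ?_
      rw [(hp v.1 v.2).2 h2] at h
      cases h
  obtain ⟨v, hv, hne⟩ := exists_iterate_stepBy_ne (p 1 0) (p 2 0) (p 3 0) (p 4 0) k (by omega)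
  have hv' : v.1 < 5 ∧ v.2 < 12 := by
    simp only [List.mem_cons, List.not_mem_nil, or_false] at hv
    rcases hv with rfl | rfl | rfl | rfl | rfl <;> simp
  have hiter : ∀ n, (((stepBy u)^[n] v).1 < 5 ∧ ((stepBy u)^[n] v).2 < 12) ∧
      ((stepBy u)^[n] v ≠ (0, 0) → n ≤ f ((stepBy u)^[n] v)) := by
    intro n
    induction n with
    | zero => exact ⟨hv', fun _ => Nat.zero_le _⟩
    | succ n ih =>
      rw [Function.iterate_succ_apply']
      obtain ⟨⟨h1, h2⟩, h3⟩ := ih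
      generalize (stepBy u)^[n] v = w at *
      by_cases hw : w = (0, 0)
      · subst hw
        rw [stepBy_zero]
        exact ⟨⟨h1, h2⟩, fun h => absurd rfl h⟩
      · refine ⟨?_, fun _ => ?_⟩
        · rw [stepBy_of_ne hw]
          cases u w.1 w.2
          · exact moveBy_lt 3 w
          · exact moveBy_lt 2 w
        · rw [hstep w h1 h2 hw]
          exact Nat.succ_le_succ (h3 hw)
  exact absurd ((hiter 60).2 hne) (not_le.2 (hb _))

section Group

variable {G : Type*} [Group G]

theorem pow_mul_eq_pow_two_pow_mul {h z : G} (hz : orderOf z = 5) (hrel : h⁻¹ * z * h = z ^ 3)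
    (j : ℕ) : h ^ j * z = z ^ 2 ^ j * h ^ j := by
  have hz5 : z ^ 5 = 1 := hz ▸ pow_orderOf_eq_one z
  have h1 : SemiconjBy h z (z ^ 2) := by
    have h3 : SemiconjBy h (z ^ 3) z := by
      rw [← hrel]
      simp [SemiconjBy, mul_assoc]
    have h6 := h3.pow_right 2
    rwa [← pow_mul, show 3 * 2 = 5 + 1 by rfl, pow_succ, hz5, one_mul] at h6
  have hj : SemiconjBy (h ^ j) z (z ^ 2 ^ j) := by
    induction j with
    | zero => simp
    | succ j ih =>
      rw [pow_succ' h, pow_succ' 2, pow_mul]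
      exact (h1.pow_right _).mul_left ih
  exact hj.eq

theorem pow_mul_pow_inj {h z : G} (hh : orderOf h = 12) (hz : orderOf z = 5) {i j i' j' : ℕ}
    (hi : i < 5) (hj : j < 12) (hi' : i' < 5) (hj' : j' < 12)
    (heq : z ^ i * h ^ j = z ^ i' * h ^ j') : i = i' ∧ j = j' := by
  have hdisj : Disjoint (Subgroup.zpowers z) (Subgroup.zpowers h) :=
    Subgroup.disjoint_of_coprime_natCard (by rw [Nat.card_zpowers, Nat.card_zpowers, hz, hh]; decide)
  have := Subgroup.mul_injective_of_disjoint hdisj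
    (a₁ := (⟨z ^ i, Subgroup.npow_mem_zpowers z i⟩, ⟨h ^ j, Subgroup.npow_mem_zpowers h j⟩))
    (a₂ := (⟨z ^ i', Subgroup.npow_mem_zpowers z i'⟩, ⟨h ^ j', Subgroup.npow_mem_zpowers h j'⟩)) heq
  simp only [Prod.mk.injEq, Subtype.mk.injEq] at this
  exact ⟨pow_injOn_Iio_orderOf (by simpa [hz] using hi) (by simpa [hz] using hi') this.1,
    pow_injOn_Iio_orderOf (by simpa [hh] using hj) (by simpa [hh] using hj') this.2⟩

theorem mul_pow_mul_pow_mul_eq {h z : G} (hh : orderOf h = 12) (hz : orderOf z = 5)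
    (hrel : h⁻¹ * z * h = z ^ 3) (t : G) (e : ℕ) (v : ℕ × ℕ) :
    t * z ^ v.1 * h ^ v.2 * (h ^ e * z) = t * z ^ (moveBy e v).1 * h ^ (moveBy e v).2 := by
  have hz' : ∀ n, z ^ (n % 5) = z ^ n := fun n => hz ▸ pow_mod_orderOf z n
  have hh' : ∀ n, h ^ (n % 12) = h ^ n := fun n => hh ▸ pow_mod_orderOf h n
  simp only [moveBy, hz', hh']
  rw [pow_add z, ← mul_assoc _ (h ^ e), mul_assoc _ (h ^ v.2), ← pow_add, mul_assoc _ _ z,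
    pow_mul_eq_pow_two_pow_mul hz hrel]
  simp only [mul_assoc]

theorem closure_pow_mul_eq_top {h z : G} (hgen : Subgroup.closure ({h, z} : Set G) = ⊤) :
    Subgroup.closure ({h ^ 2 * z, h ^ 3 * z} : Set G) = ⊤ := by
  have ha : h ^ 2 * z ∈ Subgroup.closure ({h ^ 2 * z, h ^ 3 * z} : Set G) :=
    Subgroup.subset_closure (by simp)
  have hb : h ^ 3 * z ∈ Subgroup.closure ({h ^ 2 * z, h ^ 3 * z} : Set G) :=
    Subgroup.subset_closure (by simp)
  generalize Subgroup.closure ({h ^ 2 * z, h ^ 3 * z} : Set G) = K at *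
  have hhK : h ∈ K := by
    have := K.mul_mem hb (K.inv_mem ha)
    rwa [show h ^ 3 * z * (h ^ 2 * z)⁻¹ = h by group] at this
  have hzK : z ∈ K := (K.mul_mem_cancel_left (K.pow_mem hhK 2)).1 ha
  rw [eq_top_iff, ← hgen, Subgroup.closure_le]
  rintro x (rfl | rfl) <;> assumption

theorem commutator_eq_zpowers [Finite G] {h z : G} (hz : orderOf z = 5) (hrel : h⁻¹ * z * h = z ^ 3)
    (hgen : Subgroup.closure ({h, z} : Set G) = ⊤) : commutator G = Subgroup.zpowers z := by
  have hz5 : z ^ 5 = 1 := hz ▸ pow_orderOf_eq_one z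
  apply le_antisymm
  · have hconj : h * z * h⁻¹ = z ^ 2 := by
      have := pow_mul_eq_pow_two_pow_mul hz hrel 1
      rw [mul_inv_eq_iff_eq_mul]
      simpa using this
    have : (Subgroup.zpowers z).Normal := by
      rw [← Subgroup.normalizer_eq_top_iff, eq_top_iff, ← hgen, Subgroup.closure_le]
      rintro x (rfl | rfl)
      · refine Subgroup.mem_normalizer_fintype fun n hn => ?_
        obtain ⟨m, rfl⟩ := Subgroup.mem_zpowers_iff.1 hn
        rw [← conj_zpow, hconj]
        exact Subgroup.zpow_mem _ (Subgroup.npow_mem_zpowers z 2) m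
      · exact Subgroup.le_normalizer (Subgroup.mem_zpowers x)
    refine Subgroup.Normal.commutator_le_of_self_sup_commutative_eq_top (H := Subgroup.zpowers h)
      ?_ inferInstance
    rw [eq_top_iff, ← hgen, Subgroup.closure_le]
    rintro x (rfl | rfl)
    · exact Subgroup.mem_sup_right (Subgroup.mem_zpowers x)
    · exact Subgroup.mem_sup_left (Subgroup.mem_zpowers x)
  · rw [Subgroup.zpowers_le]
    have h2 : z ^ 2 ∈ commutator G := by
      have := Subgroup.commutator_mem_commutator (Subgroup.mem_top h⁻¹) (Subgroup.mem_top z)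
      rwa [← commutator_def, commutatorElement_def, inv_inv, hrel, pow_succ, mul_inv_cancel_right] at this
    have h6 := Subgroup.pow_mem _ h2 3
    rwa [← pow_mul, show 2 * 3 = 5 + 1 by rfl, pow_succ, hz5, one_mul] at h6

theorem IsHamiltonianPath.exists_ordering [Finite G] {S : Set G} {l : List G}
    (hl : IsHamiltonianPath S l) :
    ∃ (t : G) (f : G → ℕ), Function.Injective f ∧ (∀ g, f g < Nat.card G) ∧
      ∀ g ≠ t, ∃ s ∈ S, f (g * s) = f g + 1 := by
  classical
  obtain ⟨hnd, hmem, hch⟩ := hl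
  have hne : l ≠ [] := List.ne_nil_of_mem (hmem 1)
  have hlt : ∀ g, l.idxOf g < l.length := fun g => List.idxOf_lt_length_iff.2 (hmem g)
  refine ⟨l.getLast hne, l.idxOf, fun x y hxy => ?_, fun g => ?_, fun g hg => ?_⟩
  · exact (List.idxOf_inj (hmem x)).1 hxy
  · have := Fintype.ofFinite G
    exact (hlt g).trans_le (Nat.card_eq_fintype_card (α := G) ▸ hnd.length_le_card)
  · have hsucc : l.idxOf g + 1 < l.length := by
      by_contra hcon
      apply hg
      have := hlt g
      rw [List.getLast_eq_getElem, ← List.getElem_idxOf (hlt g)]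
      congr 1
      omega
    obtain ⟨s, hs, heq⟩ := List.isChain_iff_getElem.1 hch _ hsucc
    refine ⟨s, hs, ?_⟩
    rw [List.getElem_idxOf] at heq
    simpa only [← heq] using hnd.idxOf_getElem _ hsucc

end Group

theorem stmt_16 {G : Type*} [Group G] [Finite G] (h z : G)
    (hh : orderOf h = 12) (hz : orderOf z = 5)
    (hrel : h⁻¹ * z * h = z ^ 3)
    (hgen : Subgroup.closure ({h, z} : Set G) = ⊤)
    (hcard : Nat.card G = 60) :
    Nat.card (commutator G) = 5 ∧
      Subgroup.closure ({h ^ 2 * z, h ^ 3 * z} : Set G) = ⊤ ∧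
      ¬ ∃ l : List G, IsHamiltonianPath ({h ^ 2 * z, h ^ 3 * z} : Set G) l := by
  refine ⟨?_, closure_pow_mul_eq_top hgen, ?_⟩
  · rw [commutator_eq_zpowers hz hrel hgen, Nat.card_zpowers, hz]
  rintro ⟨l, hl⟩
  obtain ⟨t, f, hinj, hlt, hstep⟩ := hl.exists_ordering
  refine false_of_moveBy_ordering (fun v => f (t * z ^ v.1 * h ^ v.2)) (fun v => hcard ▸ hlt _)
    (fun i j i' j' hi hj hi' hj' heq => ?_) fun v hi hj hne => ?_
  · have := hinj heq
    simp only [mul_assoc, mul_right_inj] at this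
    exact pow_mul_pow_inj hh hz hi hj hi' hj' this
  · obtain ⟨s, hs, heq⟩ := hstep (t * z ^ v.1 * h ^ v.2) fun ht => hne <| by
      rw [mul_assoc, mul_eq_left] at ht
      have := pow_mul_pow_inj hh hz hi hj (by norm_num : 0 < 5) (by norm_num : 0 < 12)
        (by simpa using ht)
      exact Prod.ext this.1 this.2
    rcases hs with rfl | rfl
    · exact Or.inl (by rwa [mul_pow_mul_pow_mul_eq hh hz hrel] at heq)
    · exact Or.inr (by rwa [mul_pow_mul_pow_mul_eq hh hz hrel] at heq)
end

section
/- Let G = A₄ × Z₂, a = ((1 2)(3 4), 1), and b = ((1 2 3), 0). Then {a,b} generates G, the commutator subgroup of G has order 4, and the Cayley digraph Cay(G; a, b) has no hamiltonian path. -/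
/-- The group `A₄ × ℤ₂`. -/
abbrev A4xZ2 : Type := alternatingGroup (Fin 4) × Multiplicative (ZMod 2)

/-- The element `a = ((1 2)(3 4), 1)`. -/
def elA : A4xZ2 :=
  (⟨Equiv.swap 0 1 * Equiv.swap 2 3, by rw [Equiv.Perm.mem_alternatingGroup]; decide⟩, Multiplicative.ofAdd 1)

/-- The element `b = ((1 2 3), 0)`: the 3-cycle `0 ↦ 1 ↦ 2 ↦ 0` is
`swap 0 2 * swap 0 1`. -/
def elB : A4xZ2 :=
  (⟨Equiv.swap 0 2 * Equiv.swap 0 1, by rw [Equiv.Perm.mem_alternatingGroup]; decide⟩, Multiplicative.ofAdd 0)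

/-- Depth-first search: is there a path of `n` steps, each applying `f` or `g`, that starts at `v`
and avoids `visited`? -/
def hasAvoidingPath {V : Type*} [DecidableEq V] (f g : V → V) : ℕ → List V → V → Bool
  | 0, _, _ => true
  | n + 1, visited, v =>
    (!(visited.elem (f v)) && hasAvoidingPath f g n (f v :: visited) (f v)) ||
      (!(visited.elem (g v)) && hasAvoidingPath f g n (g v :: visited) (g v))

theorem hasAvoidingPath_of_isChain {V : Type*} [DecidableEq V] {f g : V → V} {l : List V} :
    ∀ {visited : List V} {v : V}, (v :: l).IsChain (fun x y => y = f x ∨ y = g x) →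
      l.Nodup → l.Disjoint visited → hasAvoidingPath f g l.length visited v = true := by
  induction l with
  | nil => intros; rfl
  | cons w l ih =>
    intro visited v hc hn hd
    rw [List.isChain_cons_cons] at hc
    rw [List.nodup_cons] at hn
    rw [List.disjoint_cons_left] at hd
    have key := ih (visited := w :: visited) hc.2 hn.2
      (List.disjoint_cons_right.2 ⟨hn.1, hd.2⟩)
    rcases hc.1 with rfl | rfl <;> simp [hasAvoidingPath, key, hd.1]

/-- The values of the permutation at `0`, `1`, `2`, written in base 4, followed by the
`ZMod 2`-component. -/
def code (g : A4xZ2) : ℕ :=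
  64 * (Multiplicative.toAdd g.2).val + 16 * (g.1.1 0).val + 4 * (g.1.1 1).val + (g.1.1 2).val

/-- Right multiplication by `elA` on codes. -/
def codeMulA (n : ℕ) : ℕ :=
  64 * (1 - n / 64) + 16 * (n / 4 % 4) + 4 * (n / 16 % 4) + (6 - n / 16 % 4 - n / 4 % 4 - n % 4)

/-- Right multiplication by `elB` on codes. -/
def codeMulB (n : ℕ) : ℕ :=
  64 * (n / 64) + 16 * (n / 4 % 4) + 4 * (n % 4) + n / 16 % 4

theorem code_injective : Function.Injective code := by
  unfold Function.Injective
  decide +kernel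

theorem code_mul_elA : ∀ g : A4xZ2, code (g * elA) = codeMulA (code g) := by
  decide +kernel

theorem code_mul_elB : ∀ g : A4xZ2, code (g * elB) = codeMulB (code g) := by
  decide +kernel

theorem not_hasAvoidingPath_code_one :
    hasAvoidingPath codeMulA codeMulB 23 [code 1] (code 1) = false := by
  decide +kernel

theorem card_A4xZ2 : Fintype.card A4xZ2 = 24 := by
  decide +kernel

theorem not_isHamiltonianPath (l : List A4xZ2) :
    ¬ IsHamiltonianPath ({elA, elB} : Set A4xZ2) l := by
  rintro ⟨hn, hmem, hc⟩
  have hlen : l.length = 24 := by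
    rw [← List.toFinset_card_of_nodup hn, ← card_A4xZ2, ← Finset.card_univ]
    congr 1
    ext g
    simp [hmem g]
  obtain _ | ⟨g, l⟩ := l
  · simp at hlen
  have hn' := hn.map (code_injective.comp (mul_right_injective g⁻¹))
  have hc' : ((g :: l).map (code ∘ (g⁻¹ * ·))).IsChain (fun x y => y = codeMulA x ∨ y = codeMulB x) := by
    rw [List.isChain_map]
    refine List.IsChain.imp ?_ hc
    rintro x y ⟨s, rfl | rfl, rfl⟩
    · exact Or.inl (by simpa [mul_assoc] using code_mul_elA (g⁻¹ * x))
    · exact Or.inr (by simpa [mul_assoc] using code_mul_elB (g⁻¹ * x))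
  have hhead : (code ∘ (g⁻¹ * ·)) g = code 1 := by simp
  rw [List.map_cons, hhead] at hn' hc'
  rw [List.nodup_cons] at hn'
  have hpath := hasAvoidingPath_of_isChain (visited := [code 1]) hc' hn'.2
    (List.disjoint_singleton.2 hn'.1)
  rw [List.length_map, show l.length = 23 by simpa using hlen,
    not_hasAvoidingPath_code_one] at hpath
  exact Bool.false_ne_true hpath

theorem exists_eq_word : ∀ g : A4xZ2, ∃ i : Fin 2, ∃ j : Fin 3, ∃ k : Fin 2, ∃ m : Fin 3,
    g = (elA * elB) ^ (3 * i.val) * elB ^ j.val * elA ^ k.val * elB ^ m.val := by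
  decide +kernel

theorem closure_elA_elB : Subgroup.closure ({elA, elB} : Set A4xZ2) = ⊤ := by
  rw [Subgroup.eq_top_iff']
  intro g
  have ha : elA ∈ Subgroup.closure ({elA, elB} : Set A4xZ2) := Subgroup.subset_closure (by simp)
  have hb : elB ∈ Subgroup.closure ({elA, elB} : Set A4xZ2) := Subgroup.subset_closure (by simp)
  obtain ⟨i, j, k, m, rfl⟩ := exists_eq_word g
  exact mul_mem (mul_mem (mul_mem (pow_mem (mul_mem ha hb) _) (pow_mem hb _)) (pow_mem ha _))
    (pow_mem hb _)

theorem card_commutator_A4xZ2 : Nat.card (commutator A4xZ2) = 4 := by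
  have h4 : Nat.card (Fin 4) = 4 := by simp
  have hcomm : commutator (Multiplicative (ZMod 2)) = ⊥ :=
    (commutator_eq_bot_iff_center_eq_top _).2 CommGroup.center_eq_top
  rw [commutator_def, ← Subgroup.top_prod_top, Subgroup.commutator_prod_prod, ← commutator_def,
    ← commutator_def, hcomm, ← alternatingGroup.kleinFour_eq_commutator h4,
    Nat.card_congr (Subgroup.prodEquiv _ _).toEquiv, Nat.card_prod,
    alternatingGroup.kleinFour_card_of_card_eq_four h4]
  simp

theorem stmt_17 :
    Subgroup.closure ({elA, elB} : Set A4xZ2) = ⊤ ∧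
      Nat.card (commutator A4xZ2) = 4 ∧
      ¬ ∃ l : List A4xZ2, IsHamiltonianPath ({elA, elB} : Set A4xZ2) l :=
  ⟨closure_elA_elB, card_commutator_A4xZ2, fun ⟨l, hl⟩ => not_isHamiltonianPath l hl⟩
end
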